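/- Suppose a family x = (x^ω_{it}) for (i,t) ∈ E, ω ∈ Ω is nonanticipative and satisfies 0 ≤ x^ω_{it} ≤ 1, ∑_{t : (i,t)∈E} x^ω_{it}·1^ω(i,t) ≤ c_i for every i ∈ I and ω ∈ Ω, and ∑_{i : (i,t)∈E} x^ω_{it} ≤ 1 for every t ∈ T and ω ∈ Ω. Then the expectations x_{it} := E_ω[x^ω_{it}] satisfy ∑_{t : (i,t)∈E} p_{it}·x_{it} ≤ c_i for every i ∈ I and ∑_{i : (i,t)∈E} x_{it} ≤ 1 for every t ∈ T, and the path-based objective equals the LP objective: E_ω[∑_{(i,t)∈E} r_i·x^ω_{it}·1^ω(i,t)] = ∑_{(i,t)∈E} p_{it}·r_i·x_{it}. Consequently OPT(PBP) ≤ OPT(LP). -/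

import Mathlib

open Finset

variable {I T : Type*}

/-- Probability of a sample path `ω : E → Bool` under the product measure where
edge `e` succeeds independently with probability `p e`. -/
noncomputable def pathWeight [Fintype I] [DecidableEq I] [Fintype T] [LinearOrder T]
    (E : Finset (I × T)) (p : I × T → ℝ) (ω : ↥E → Bool) : ℝ :=
  ∏ e : ↥E, if ω e then p e.val else 1 - p e.val

/-- Expectation over sample paths `ω : E → Bool`. -/
noncomputable def pExp [Fintype I] [DecidableEq I] [Fintype T] [LinearOrder T]
    (E : Finset (I × T)) (p : I × T → ℝ) (f : (↥E → Bool) → ℝ) : ℝ :=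
  ∑ ω : ↥E → Bool, pathWeight E p ω * f ω

/-- The optimal value `OPT(LP)` of the expectation LP with capacities `c`. -/
noncomputable def lpOpt [Fintype I] [DecidableEq I] [Fintype T] [LinearOrder T]
    (E : Finset (I × T)) (p : I × T → ℝ) (r : I → ℝ) (c : I → ℕ) : ℝ :=
  sSup { v : ℝ | ∃ x : ↥E → ℝ,
    (∀ e, 0 ≤ x e ∧ x e ≤ 1) ∧
    (∀ i : I, ∑ e ∈ univ.filter (fun e : ↥E => e.val.1 = i), p e.val * x e ≤ (c i : ℝ)) ∧
    (∀ t : T, ∑ e ∈ univ.filter (fun e : ↥E => e.val.2 = t), x e ≤ 1) ∧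
    v = ∑ e : ↥E, p e.val * r e.val.1 * x e }

/-- The optimal value `OPT(PBP)` of the path-based program with capacities `c`:
the supremum of the expected reward over feasible nonanticipative families. -/
noncomputable def pbpOpt [Fintype I] [DecidableEq I] [Fintype T] [LinearOrder T]
    (E : Finset (I × T)) (p : I × T → ℝ) (r : I → ℝ) (c : I → ℕ) : ℝ :=
  sSup { v : ℝ | ∃ x : ↥E → (↥E → Bool) → ℝ,
    (∀ e ω, 0 ≤ x e ω ∧ x e ω ≤ 1) ∧
    (∀ (e : ↥E) (ω ω' : ↥E → Bool),
      (∀ e' : ↥E, e'.val.2 < e.val.2 → ω e' = ω' e') → x e ω = x e ω') ∧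
    (∀ (i : I) (ω : ↥E → Bool),
      ∑ e ∈ univ.filter (fun e : ↥E => e.val.1 = i),
        x e ω * (if ω e then (1 : ℝ) else 0) ≤ (c i : ℝ)) ∧
    (∀ (t : T) (ω : ↥E → Bool),
      ∑ e ∈ univ.filter (fun e : ↥E => e.val.2 = t), x e ω ≤ 1) ∧
    v = pExp E p (fun ω => ∑ e : ↥E, r e.val.1 * x e ω * (if ω e then (1 : ℝ) else 0)) }

section Expectation

variable [Fintype I] [DecidableEq I] [Fintype T] [LinearOrder T]
  {E : Finset (I × T)} {p : I × T → ℝ}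

lemma pathWeight_nonneg (hp : ∀ e ∈ E, 0 ≤ p e ∧ p e ≤ 1) (ω : ↥E → Bool) :
    0 ≤ pathWeight E p ω := by
  refine prod_nonneg fun e _ => ?_
  have := hp e.val e.property
  split_ifs <;> linarith

lemma sum_pathWeight : ∑ ω : ↥E → Bool, pathWeight E p ω = 1 := by
  have h := Finset.prod_univ_sum (fun _ : ↥E => (univ : Finset Bool))
    (fun e b => if b then p e.val else 1 - p e.val)
  simp only [Fintype.piFinset_univ] at h
  simp only [pathWeight, ← h]
  exact prod_eq_one fun e _ => by simp

lemma pExp_const (a : ℝ) : pExp E p (fun _ => a) = a := by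
  rw [pExp, ← sum_mul, sum_pathWeight, one_mul]

lemma pExp_mono (hp : ∀ e ∈ E, 0 ≤ p e ∧ p e ≤ 1) {f g : (↥E → Bool) → ℝ}
    (h : ∀ ω, f ω ≤ g ω) : pExp E p f ≤ pExp E p g :=
  sum_le_sum fun ω _ => mul_le_mul_of_nonneg_left (h ω) (pathWeight_nonneg hp ω)

lemma pExp_sum {ι : Type*} (s : Finset ι) (f : ι → (↥E → Bool) → ℝ) :
    pExp E p (fun ω => ∑ i ∈ s, f i ω) = ∑ i ∈ s, pExp E p (f i) := by
  simp only [pExp, mul_sum]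
  exact sum_comm

lemma pExp_const_mul (a : ℝ) (f : (↥E → Bool) → ℝ) :
    pExp E p (fun ω => a * f ω) = a * pExp E p f := by
  simp only [pExp, mul_sum, mul_left_comm]

lemma pathWeight_eq_mul_prod_erase (e : ↥E) (ω : ↥E → Bool) :
    pathWeight E p ω = (if ω e then p e.val else 1 - p e.val) *
      ∏ e' ∈ univ.erase e, if ω e' then p e'.val else 1 - p e'.val :=
  (mul_prod_erase univ _ (mem_univ e)).symm

/-- A function that ignores the outcome of edge `e` is uncorrelated with that outcome. -/
lemma pExp_mul_indicator (e : ↥E) (f : (↥E → Bool) → ℝ)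
    (hf : ∀ ω b, f (Function.update ω e b) = f ω) :
    pExp E p (fun ω => f ω * (if ω e then (1 : ℝ) else 0)) = p e.val * pExp E p f := by
  rw [← sub_eq_zero, pExp, pExp, mul_sum, ← sum_sub_distrib]
  refine sum_involution (fun ω _ => Function.update ω e (!ω e)) (fun ω _ => ?_)
    (fun ω _ _ h => ?_) (fun _ _ => mem_univ _) (fun ω _ => by simp)
  · have hprod : ∏ e' ∈ univ.erase e,
        (if Function.update ω e (!ω e) e' then p e'.val else 1 - p e'.val) =
        ∏ e' ∈ univ.erase e, if ω e' then p e'.val else 1 - p e'.val :=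
      prod_congr rfl fun e' he' => by rw [Function.update_of_ne (ne_of_mem_erase he')]
    rw [pathWeight_eq_mul_prod_erase e ω, pathWeight_eq_mul_prod_erase e (Function.update ω e _),
      hprod, hf, Function.update_self]
    cases ω e <;> simp <;> ring
  · simpa using congrFun h e

lemma pExp_mul_indicator_of_nonanticipative {x : ↥E → (↥E → Bool) → ℝ}
    (hx : ∀ (e : ↥E) (ω ω' : ↥E → Bool),
      (∀ e' : ↥E, e'.val.2 < e.val.2 → ω e' = ω' e') → x e ω = x e ω') (e : ↥E) :
    pExp E p (fun ω => x e ω * (if ω e then (1 : ℝ) else 0)) =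
      p e.val * pExp E p (fun ω => x e ω) := by
  refine pExp_mul_indicator e _ fun ω b => hx e _ _ fun e' he' => ?_
  exact Function.update_of_ne (fun h => he'.ne (by rw [h])) _ _

lemma pExp_capacity_le (hp : ∀ e ∈ E, 0 ≤ p e ∧ p e ≤ 1) {x : ↥E → (↥E → Bool) → ℝ}
    (hx : ∀ (e : ↥E) (ω ω' : ↥E → Bool),
      (∀ e' : ↥E, e'.val.2 < e.val.2 → ω e' = ω' e') → x e ω = x e ω')
    (s : Finset ↥E) {a : ℝ}
    (h : ∀ ω, ∑ e ∈ s, x e ω * (if ω e then (1 : ℝ) else 0) ≤ a) :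
    ∑ e ∈ s, p e.val * pExp E p (fun ω => x e ω) ≤ a := by
  have := pExp_mono hp h
  rwa [pExp_const, pExp_sum,
    sum_congr rfl fun e _ => pExp_mul_indicator_of_nonanticipative hx e] at this

lemma pExp_sum_le (hp : ∀ e ∈ E, 0 ≤ p e ∧ p e ≤ 1) {x : ↥E → (↥E → Bool) → ℝ}
    (s : Finset ↥E) {a : ℝ} (h : ∀ ω, ∑ e ∈ s, x e ω ≤ a) :
    ∑ e ∈ s, pExp E p (fun ω => x e ω) ≤ a := by
  have := pExp_mono hp h
  rwa [pExp_const, pExp_sum] at this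

lemma pExp_reward_eq (r : I → ℝ) {x : ↥E → (↥E → Bool) → ℝ}
    (hx : ∀ (e : ↥E) (ω ω' : ↥E → Bool),
      (∀ e' : ↥E, e'.val.2 < e.val.2 → ω e' = ω' e') → x e ω = x e ω') :
    pExp E p (fun ω => ∑ e : ↥E, r e.val.1 * x e ω * (if ω e then (1 : ℝ) else 0)) =
      ∑ e : ↥E, p e.val * r e.val.1 * pExp E p (fun ω => x e ω) := by
  rw [pExp_sum]
  refine sum_congr rfl fun e _ => ?_
  simp only [mul_assoc]
  rw [pExp_const_mul, pExp_mul_indicator_of_nonanticipative hx, mul_left_comm]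

lemma pExp_mem_unitInterval (hp : ∀ e ∈ E, 0 ≤ p e ∧ p e ≤ 1) {f : (↥E → Bool) → ℝ}
    (hf : ∀ ω, 0 ≤ f ω ∧ f ω ≤ 1) : 0 ≤ pExp E p f ∧ pExp E p f ≤ 1 := by
  have h0 := pExp_mono hp fun ω => (hf ω).1
  have h1 := pExp_mono hp fun ω => (hf ω).2
  rw [pExp_const] at h0 h1
  exact ⟨h0, h1⟩

lemma pbpOpt_le_lpOpt (r : I → ℝ) (c : I → ℕ) (hp : ∀ e ∈ E, 0 ≤ p e ∧ p e ≤ 1)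
    (hr : ∀ i, 0 ≤ r i) : pbpOpt E p r c ≤ lpOpt E p r c := by
  refine csSup_le_csSup ⟨∑ e : ↥E, p e.val * r e.val.1, ?_⟩
    ⟨_, fun _ _ => 0, by simp, by simp, by simp, by simp, rfl⟩ ?_
  · rintro v ⟨x, hx01, -, -, rfl⟩
    exact sum_le_sum fun e _ =>
      mul_le_of_le_one_right (mul_nonneg (hp e.val e.property).1 (hr _)) (hx01 e).2
  · rintro v ⟨x, hx01, hx, hcap, hmatch, rfl⟩
    exact ⟨fun e => pExp E p (fun ω => x e ω), fun e => pExp_mem_unitInterval hp (hx01 e),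
      fun i => pExp_capacity_le hp hx _ (hcap i), fun t => pExp_sum_le hp _ (hmatch t),
      pExp_reward_eq r hx⟩

end Expectation

/-- any feasible nonanticipative solution of the path-based program
yields, by taking expectations, a feasible solution of the expectation LP with the
same objective value; consequently `OPT(PBP) ≤ OPT(LP)`. -/
theorem stmt2 [Fintype I] [DecidableEq I] [Fintype T] [LinearOrder T]
    (E : Finset (I × T)) (p : I × T → ℝ) (r : I → ℝ) (c : I → ℕ)
    (hp : ∀ e ∈ E, 0 ≤ p e ∧ p e ≤ 1) (hr : ∀ i, 0 ≤ r i) (hc : ∀ i, 1 ≤ c i)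
    (x : ↥E → (↥E → Bool) → ℝ)
    (hx01 : ∀ e ω, 0 ≤ x e ω ∧ x e ω ≤ 1)
    (hnonant : ∀ (e : ↥E) (ω ω' : ↥E → Bool),
      (∀ e' : ↥E, e'.val.2 < e.val.2 → ω e' = ω' e') → x e ω = x e ω')
    (hcap : ∀ (i : I) (ω : ↥E → Bool),
      ∑ e ∈ univ.filter (fun e : ↥E => e.val.1 = i),
        x e ω * (if ω e then (1 : ℝ) else 0) ≤ (c i : ℝ))
    (hmatch : ∀ (t : T) (ω : ↥E → Bool),
      ∑ e ∈ univ.filter (fun e : ↥E => e.val.2 = t), x e ω ≤ 1) :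
    (∀ i : I, ∑ e ∈ univ.filter (fun e : ↥E => e.val.1 = i),
        p e.val * pExp E p (fun ω => x e ω) ≤ (c i : ℝ)) ∧
    (∀ t : T, ∑ e ∈ univ.filter (fun e : ↥E => e.val.2 = t),
        pExp E p (fun ω => x e ω) ≤ 1) ∧
    pExp E p (fun ω => ∑ e : ↥E, r e.val.1 * x e ω * (if ω e then (1 : ℝ) else 0)) =
      ∑ e : ↥E, p e.val * r e.val.1 * pExp E p (fun ω => x e ω) ∧
    pbpOpt E p r c ≤ lpOpt E p r c := by
  exact ⟨fun i => pExp_capacity_le hp hnonant _ (hcap i), fun t => pExp_sum_le hp _ (hmatch t),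
    pExp_reward_eq r hnonant, pbpOpt_le_lpOpt r c hp hr⟩
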